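/- For every integer n ≥ 13, the graph G_n^∘ is 3-connected. -/

import Mathlib

/-- Labels in `Fin 12`: `0 = h¹`, `1 = h²`, `2 = h₁`, `3 = h₂`, `4 = h₃`,
`5 = h₁¹`, `6 = h₂¹`, `7 = h₃¹`, `8 = h₁²`, `9 = h₂²`, `10 = t₁`, `11 = t₂`.
The edges among these vertices, including the five dashed edges. -/
def circBase : List (Fin 12 × Fin 12) :=
  [(0,10),(10,5),(0,11),(11,6),(10,11),(0,7),
   (1,8),(1,9),
   (2,5),(2,8),(2,7),
   (3,5),(3,8),(3,6),(3,9),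
   (4,6),(4,9),(4,7),
   (2,3),(3,4),(4,2),(2,1),(4,1)]

/-- The graph `G_n^∘` for `n ≥ 13`.  The vertex `Sum.inr k` is `v_{k+1}`,
for `0 ≤ k ≤ n - 13`, so that `v₁ = Sum.inr 0` and `v_{n-12} = Sum.inr (n-13)`. -/
def GCirc (n : ℕ) : SimpleGraph (Fin 12 ⊕ Fin (n - 12)) :=
  SimpleGraph.fromRel (fun a b =>
    match a, b with
    | Sum.inl i, Sum.inl j => (i, j) ∈ circBase
    | Sum.inl i, Sum.inr k =>
        (i = 2 ∧ (k : ℕ) = 0) ∨ (i = 4 ∧ (k : ℕ) = n - 13) ∨ i = 1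
    | Sum.inr _, Sum.inl _ => False
    | Sum.inr k, Sum.inr l => (l : ℕ) = (k : ℕ) + 1)

/-- A graph is 3-connected if it has more than 3 vertices and removing any set of
at most 2 vertices leaves the induced subgraph on the remaining vertices connected. -/
def ThreeConnected {V : Type*} [Fintype V] (G : SimpleGraph V) : Prop :=
  3 < Fintype.card V ∧
    ∀ S : Finset V, S.card ≤ 2 → (G.induce ((↑S : Set V)ᶜ)).Connected

/-- If the vertices `h 0, h 1, h 2` are pairwise adjacent and every vertex `x` has walks to
`h 0`, `h 1` and `h 2` that pairwise meet only in `x`, then the graph is 3-connected. -/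
theorem threeConnected_of_fans {V : Type*} [Fintype V] {G : SimpleGraph V}
    (hcard : 3 < Fintype.card V) (h : Fin 3 → V) (hadj : Pairwise fun i j => G.Adj (h i) (h j))
    (hfan : ∀ x, ∃ A : Fin 3 → Set V, Pairwise (fun i j => Disjoint (A i) (A j)) ∧
      ∀ i, ∃ p : G.Walk x (h i), ∀ v ∈ p.support, v = x ∨ v ∈ A i) :
    ThreeConnected G := by
  refine ⟨hcard, fun S hS => ?_⟩
  have reach_hub (x : V) (hx : x ∈ (S : Set V)ᶜ) : ∃ i, ∃ hi : h i ∈ (S : Set V)ᶜ,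
      (G.induce (S : Set V)ᶜ).Reachable ⟨x, hx⟩ ⟨h i, hi⟩ := by
    obtain ⟨A, hA, hp⟩ := hfan x
    obtain ⟨i, hi⟩ : ∃ i, ∀ s ∈ S, s ∉ A i := by
      by_contra! hc
      choose s hsS hsA using hc
      have hinj : Function.Injective s := fun i j hij => by
        by_contra hne
        exact Set.disjoint_left.1 (hA hne) (hsA i) (hij ▸ hsA j)
      have := Finset.card_le_card_of_injOn (s := Finset.univ) (t := S) s
        (fun i _ => hsS i) hinj.injOn
      rw [Finset.card_univ, Fintype.card_fin] at this
      omega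
    obtain ⟨p, hp⟩ := hp i
    have hw : ∀ v ∈ p.support, v ∈ (S : Set V)ᶜ := by
      intro v hv hvS
      rcases hp v hv with rfl | hvA
      · exact hx hvS
      · exact hi v hvS hvA
    exact ⟨i, hw _ p.end_mem_support, ⟨p.induce _ hw⟩⟩
  obtain ⟨x₀, hx₀⟩ : ∃ x, x ∉ S := by
    by_contra! hc
    have := Finset.card_univ (α := V)
    rw [← Finset.eq_univ_iff_forall.2 hc] at this
    omega
  have : Nonempty ((S : Set V)ᶜ : Set V) := ⟨⟨x₀, hx₀⟩⟩
  refine ⟨fun ⟨x, hx⟩ ⟨y, hy⟩ => ?_⟩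
  obtain ⟨i, hi, hxi⟩ := reach_hub x hx
  obtain ⟨j, hj, hyj⟩ := reach_hub y hy
  refine hxi.trans (.trans ?_ hyj.symm)
  rcases eq_or_ne i j with rfl | hij
  · rfl
  · exact SimpleGraph.Adj.reachable (G := G.induce _) (hadj hij)

/-- The graph induced by `GCirc n` on the twelve vertices outside the path. -/
def circBaseGraph : SimpleGraph (Fin 12) :=
  SimpleGraph.fromRel fun i j => (i, j) ∈ circBase

instance : DecidableRel circBaseGraph.Adj := fun i j =>
  inferInstanceAs (Decidable (i ≠ j ∧ ((i, j) ∈ circBase ∨ (j, i) ∈ circBase)))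

/-- The triangle `h₁ h₂ h₃`. -/
def circHub : Fin 3 → Fin 12 := ![2, 3, 4]

/-- Three paths from a vertex to the triangle `h₁ h₂ h₃`, without their common first vertex. -/
def circFan : Fin 12 → Fin 3 → List (Fin 12) :=
  ![![[7, 2], [10, 5, 3], [11, 6, 4]],
    ![[2], [8, 3], [4]],
    ![[], [3], [4]],
    ![[2], [], [4]],
    ![[2], [3], []],
    ![[2], [3], [10, 0, 7, 4]],
    ![[11, 10, 5, 2], [3], [4]],
    ![[2], [0, 10, 5, 3], [4]],
    ![[2], [3], [1, 4]],
    ![[1, 2], [3], [4]],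
    ![[5, 2], [11, 6, 3], [0, 7, 4]],
    ![[10, 5, 2], [6, 3], [0, 7, 4]]]

theorem circFan_isChain : ∀ x i, (x :: circFan x i).IsChain circBaseGraph.Adj := by
  decide

theorem circFan_getLast : ∀ x i,
    (x :: circFan x i).getLast (List.cons_ne_nil _ _) = circHub i := by
  decide

theorem circFan_disjoint : ∀ x i j, i ≠ j → ∀ y ∈ circFan x i, y ∉ circFan x j := by
  decide

/-- The inclusion of the twelve vertices outside the path. -/
def circBaseHom (n : ℕ) : circBaseGraph →g GCirc n where
  toFun := Sum.inl
  map_rel' := by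
    intro i j hij
    exact ⟨fun h => hij.1 (Sum.inl.inj h), hij.2⟩

theorem exists_walk_circFan (n : ℕ) (x : Fin 12) (i : Fin 3) :
    ∃ p : (GCirc n).Walk (Sum.inl x) (Sum.inl (circHub i)),
      p.support = (x :: circFan x i).map Sum.inl := by
  rw [← circFan_getLast x i]
  let p := SimpleGraph.Walk.ofSupport _ (List.cons_ne_nil _ _) (circFan_isChain x i)
  exact ⟨p.map (circBaseHom n), (p.support_map _).trans
    (congrArg _ (SimpleGraph.Walk.support_ofSupport _ _))⟩

theorem gCirc_adj_path {n : ℕ} {k l : Fin (n - 12)} (h : (l : ℕ) = k + 1) :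
    (GCirc n).Adj (Sum.inr k) (Sum.inr l) :=
  ⟨fun e => by have := Sum.inr.inj e; omega, Or.inl h⟩

theorem exists_walk_first {n : ℕ} (m : ℕ) (hm : m < n - 12) :
    ∃ p : (GCirc n).Walk (Sum.inr ⟨m, hm⟩) (Sum.inl 2),
      ∀ v ∈ p.support, v = Sum.inl 2 ∨ ∃ l : Fin (n - 12), (l : ℕ) ≤ m ∧ v = Sum.inr l := by
  induction m with
  | zero =>
    have hadj : (GCirc n).Adj (Sum.inr ⟨0, hm⟩) (Sum.inl 2) :=
      ⟨Sum.inr_ne_inl, Or.inr (Or.inl ⟨rfl, rfl⟩)⟩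
    refine ⟨hadj.toWalk, ?_⟩
    simp
  | succ m ih =>
    obtain ⟨p, hp⟩ := ih (by omega)
    refine ⟨.cons (gCirc_adj_path rfl).symm p, fun v hv => ?_⟩
    rcases List.mem_cons.1 hv with rfl | hv
    · exact Or.inr ⟨_, le_rfl, rfl⟩
    · exact (hp v hv).imp_right fun ⟨l, hl, e⟩ => ⟨l, by omega, e⟩

theorem exists_walk_last {n : ℕ} (d m : ℕ) (hm : m < n - 12) (hd : m + d = n - 13) :
    ∃ p : (GCirc n).Walk (Sum.inr ⟨m, hm⟩) (Sum.inl 4),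
      ∀ v ∈ p.support, v = Sum.inl 4 ∨ ∃ l : Fin (n - 12), m ≤ (l : ℕ) ∧ v = Sum.inr l := by
  induction d generalizing m with
  | zero =>
    have hadj : (GCirc n).Adj (Sum.inr ⟨m, hm⟩) (Sum.inl 4) :=
      ⟨Sum.inr_ne_inl, Or.inr (Or.inr (Or.inl ⟨rfl, hd⟩))⟩
    refine ⟨hadj.toWalk, ?_⟩
    simp
  | succ d ih =>
    obtain ⟨p, hp⟩ := ih (m + 1) (by omega) (by omega)
    refine ⟨.cons (gCirc_adj_path rfl) p, fun v hv => ?_⟩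
    rcases List.mem_cons.1 hv with rfl | hv
    · exact Or.inr ⟨_, le_rfl, rfl⟩
    · exact (hp v hv).imp_right fun ⟨l, hl, e⟩ => ⟨l, by omega, e⟩

theorem exists_walk_middle {n : ℕ} (k : Fin (n - 12)) :
    ∃ p : (GCirc n).Walk (Sum.inr k) (Sum.inl 3),
      p.support = [Sum.inr k, Sum.inl 1, Sum.inl 8, Sum.inl 3] := by
  obtain ⟨p, hp⟩ := exists_walk_circFan n 1 1
  have hadj : (GCirc n).Adj (Sum.inr k) (Sum.inl 1) :=
    ⟨Sum.inr_ne_inl, Or.inr (Or.inr (Or.inr rfl))⟩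
  exact ⟨.cons hadj p, congrArg (Sum.inr k :: ·) hp⟩

theorem gCirc_threeConnected (n : ℕ) (hn : 13 ≤ n) :
    ThreeConnected (GCirc n) := by
  refine threeConnected_of_fans (by simp; omega) (fun i => Sum.inl (circHub i))
    (fun i j hij => (circBaseHom n).map_adj ?_) ?_
  · revert i j
    decide
  rintro (x | k)
  · refine ⟨fun i => {v | ∃ y ∈ circFan x i, v = Sum.inl y}, fun i j hij => ?_, fun i => ?_⟩
    · refine Set.disjoint_left.2 ?_
      rintro _ ⟨y, hy, rfl⟩ ⟨z, hz, e⟩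
      obtain rfl := Sum.inl.inj e
      exact circFan_disjoint x i j hij y hy hz
    · obtain ⟨p, hp⟩ := exists_walk_circFan n x i
      refine ⟨p, fun v hv => ?_⟩
      rw [hp] at hv
      obtain ⟨y, hy, rfl⟩ := List.mem_map.1 hv
      rcases List.mem_cons.1 hy with rfl | hy
      · exact Or.inl rfl
      · exact Or.inr ⟨y, hy, rfl⟩
  · refine ⟨![{v | v = Sum.inl 2 ∨ ∃ l, l < k ∧ v = Sum.inr l},
      {Sum.inl 1, Sum.inl 8, Sum.inl 3},
      {v | v = Sum.inl 4 ∨ ∃ l, k < l ∧ v = Sum.inr l}], fun i j hij => ?_, fun i => ?_⟩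
    · refine Set.disjoint_left.2 ?_
      rintro (y | l) <;> fin_cases i <;> fin_cases j <;> simp at hij ⊢ <;> grind
    · fin_cases i
      · obtain ⟨p, hp⟩ := exists_walk_first k k.2
        refine ⟨p, fun v hv => ?_⟩
        rcases hp v hv with rfl | ⟨l, hl, rfl⟩
        · exact Or.inr (Or.inl rfl)
        · rcases eq_or_lt_of_le (Fin.le_def.2 hl) with rfl | hlt
          · exact Or.inl rfl
          · exact Or.inr (Or.inr ⟨l, hlt, rfl⟩)
      · obtain ⟨p, hp⟩ := exists_walk_middle k
        refine ⟨p, fun v hv => ?_⟩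
        replace hv := hp ▸ hv
        simpa using hv
      · obtain ⟨p, hp⟩ := exists_walk_last (n - 13 - k) k k.2 (by omega)
        refine ⟨p, fun v hv => ?_⟩
        rcases hp v hv with rfl | ⟨l, hl, rfl⟩
        · exact Or.inr (Or.inl rfl)
        · rcases eq_or_lt_of_le (Fin.le_def.2 hl) with h | hlt
          · exact Or.inl (congrArg Sum.inr h.symm)
          · exact Or.inr (Or.inr ⟨l, hlt, rfl⟩)
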